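/- arXiv:2406.01799 — 2 statements merged into one kernel-verified Lean document; each statement's English description precedes it below -/
import Mathlib

section
/- Consider a simplex LDS with transition matrices A, B ∈ S^d, initial state x₁ ∈ Δ^d, noise strengths γ_t ∈ [0,1] and noise values w_t ∈ Δ^d. Fix H ∈ ℕ, a ∈ [0,1], p ∈ Δ^d_a and M^{[1]},…,M^{[H]} ∈ S^d_a, and suppose the controls are chosen as u_s := λ_{s,0}·p + ∑_{j=1}^H λ_{s,j}·M^{[j]} w_{s−j} at every step s. Then for every t, writing α := ‖p‖₁, the state satisfies x_t = ∑_{i=1}^t (1−α)^{i−1} · A^{i−1} · ( λ_{t−i,0}·λ̄_{t,i}·B p + B·∑_{j=1}^H λ_{t,i+j}·M^{[j]} w_{t−i−j} + λ_{t,i}·w_{t−i} ). -/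
open Finset

noncomputable section

/-- The ℓ¹ norm of a vector in `ℝ^d`. -/
def l1 {d : ℕ} (x : Fin d → ℝ) : ℝ := ∑ i, |x i|

/-- The probability simplex `Δ^d ⊆ ℝ^d`. -/
def simplex (d : ℕ) : Set (Fin d → ℝ) := {x | (∀ i, 0 ≤ x i) ∧ ∑ i, x i = 1}

/-- The scaled simplex `Δ^d_a := a · Δ^d`. -/
def scaledSimplex (d : ℕ) (a : ℝ) : Set (Fin d → ℝ) := {x | ∃ y ∈ simplex d, x = a • y}

/-- `I = ∪_{α ∈ [alb, aub]} Δ^d_α`, the set of valid controls. -/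
def ISet (d : ℕ) (alb aub : ℝ) : Set (Fin d → ℝ) :=
  {u | ∃ α ∈ Set.Icc alb aub, u ∈ scaledSimplex d α}

/-- A column-stochastic matrix: nonnegative entries, every column sums to 1. -/
def IsStochastic {d : ℕ} (M : Matrix (Fin d) (Fin d) ℝ) : Prop :=
  (∀ i j, 0 ≤ M i j) ∧ ∀ j, ∑ i, M i j = 1

/-- `S^d_a := a · S^d`, scaled column-stochastic matrices. -/
def scaledStochastic (d : ℕ) (a : ℝ) : Set (Matrix (Fin d) (Fin d) ℝ) :=
  {M | ∃ N, IsStochastic N ∧ M = a • N}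

/-- `S^d_{≤1} := ∪_{a ∈ [0,1]} a · S^d`. -/
def stochasticLeOne (d : ℕ) : Set (Matrix (Fin d) (Fin d) ℝ) :=
  {M | ∃ a ∈ Set.Icc (0:ℝ) 1, M ∈ scaledStochastic d a}

/-- The `1 → 1` operator norm `‖M‖_{1→1} = sup_{‖x‖₁ = 1} ‖Mx‖₁`. -/
def norm11 {d : ℕ} (M : Matrix (Fin d) (Fin d) ℝ) : ℝ :=
  sSup ((fun x => l1 (M.mulVec x)) '' {x : Fin d → ℝ | l1 x = 1})

/-- `X` has a unique stationary distribution. -/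
def hasUniqueStationary {d : ℕ} (X : Matrix (Fin d) (Fin d) ℝ) : Prop :=
  ∃! π : Fin d → ℝ, π ∈ simplex d ∧ X.mulVec π = π

-- The unique stationary distribution of `X` (junk value `0` if not unique).
open Classical in
def statDist {d : ℕ} (X : Matrix (Fin d) (Fin d) ℝ) : Fin d → ℝ :=
  if h : hasUniqueStationary X then h.exists.choose else 0

/-- `D_X(t) := sup_{p ∈ Δ^d} ‖X^t p − π‖₁`. -/
def Dmix {d : ℕ} (X : Matrix (Fin d) (Fin d) ℝ) (t : ℕ) : ℝ :=
  sSup ((fun p => l1 ((X ^ t).mulVec p - statDist X)) '' simplex d)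

/-- `t_mix(X, ε) := min {t : D_X(t) ≤ ε}`, as an extended natural number
(`⊤` if `X` has no unique stationary distribution or never mixes). -/
def tmix {d : ℕ} (X : Matrix (Fin d) (Fin d) ℝ) (ε : ℝ) : ℕ∞ :=
  sInf ((fun t : ℕ => (t : ℕ∞)) '' {t : ℕ | hasUniqueStationary X ∧ Dmix X t ≤ ε})

/-- `t_mix(X) ≤ r` (with the convention `t_mix(X) = t_mix(X, 1/4)`), for a real bound `r`. -/
def tmixLE {d : ℕ} (X : Matrix (Fin d) (Fin d) ℝ) (r : ℝ) : Prop :=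
  ∃ t : ℕ, (t : ℝ) ≤ r ∧ hasUniqueStationary X ∧ Dmix X t ≤ 1/4

/-- `C(K) := (1 − ‖K‖_{1→1}) · A + B K`. -/
def CK {d : ℕ} (A B K : Matrix (Fin d) (Fin d) ℝ) : Matrix (Fin d) (Fin d) ℝ :=
  (1 - norm11 K) • A + B * K

/-- `λ_{t,i} := γ_{t−i} ∏_{j=1}^{i−1} (1 − γ_{t−j})`. -/
def lam (γ : ℤ → ℝ) (t i : ℕ) : ℝ :=
  γ ((t : ℤ) - i) * ∏ j ∈ Finset.Ico 1 i, (1 - γ ((t : ℤ) - j))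

/-- `λ̄_{t,i} := ∏_{j=1}^{i} (1 − γ_{t−j})`. -/
def lamBar (γ : ℤ → ℝ) (t i : ℕ) : ℝ := ∏ j ∈ Finset.Icc 1 i, (1 - γ ((t : ℤ) - j))

/-- `λ_{t,0} := 1 − ∑_{i=1}^{H} λ_{t,i}`. -/
def lam0 (γ : ℤ → ℝ) (H t : ℕ) : ℝ := 1 - ∑ i ∈ Finset.Icc 1 H, lam γ t i

/-- The state trajectory of a simplex LDS under a given sequence of controls `u`:
`x_1` is the initial state and
`x_{t+1} = (1−γ_t)[(1−‖u_t‖₁) A x_t + B u_t] + γ_t w_t` for `t ≥ 1`. -/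
def traj {d : ℕ} (A B : Matrix (Fin d) (Fin d) ℝ) (γ : ℤ → ℝ) (w : ℤ → Fin d → ℝ)
    (x1 : Fin d → ℝ) (u : ℕ → Fin d → ℝ) : ℕ → Fin d → ℝ
  | 0 => x1
  | 1 => x1
  | t + 2 =>
      (1 - γ ((t : ℤ) + 1)) •
          ((1 - l1 (u (t + 1))) • A.mulVec (traj A B γ w x1 u (t + 1)) +
            B.mulVec (u (t + 1))) +
        γ ((t : ℤ) + 1) • w ((t : ℤ) + 1)

/-- The state trajectory of a simplex LDS under the linear policy `u_t = K x_t`. -/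
def trajK {d : ℕ} (A B : Matrix (Fin d) (Fin d) ℝ) (γ : ℤ → ℝ) (w : ℤ → Fin d → ℝ)
    (x1 : Fin d → ℝ) (K : Matrix (Fin d) (Fin d) ℝ) : ℕ → Fin d → ℝ
  | 0 => x1
  | 1 => x1
  | t + 2 =>
      (1 - γ ((t : ℤ) + 1)) •
          ((1 - l1 (K.mulVec (trajK A B γ w x1 K (t + 1)))) •
              A.mulVec (trajK A B γ w x1 K (t + 1)) +
            B.mulVec (K.mulVec (trajK A B γ w x1 K (t + 1)))) +
        γ ((t : ℤ) + 1) • w ((t : ℤ) + 1)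

/-- The disturbance-action control with parameters `(p, M^{[1:H]})`:
`u_s = λ_{s,0} p + ∑_{j=1}^H λ_{s,j} M^{[j]} w_{s−j}`. -/
def dacCtrl {d : ℕ} (γ : ℤ → ℝ) (w : ℤ → Fin d → ℝ) (H : ℕ) (p : Fin d → ℝ)
    (M : ℕ → Matrix (Fin d) (Fin d) ℝ) (s : ℕ) : Fin d → ℝ :=
  lam0 γ H s • p + ∑ j ∈ Finset.Icc 1 H, lam γ s j • (M j).mulVec (w ((s : ℤ) - j))

/-- Entropy of a sub-distribution `v ∈ Δ^d_{≤1}`. -/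
def Ent (d : ℕ) (v : Fin d → ℝ) : ℝ :=
  (1 - ∑ j, v j) * Real.log (1 / (1 - ∑ j, v j)) + ∑ j, v j * Real.log (1 / v j)

/-- The regularizer `Rgpc(p, M^{[1:H]}) = −Ent(p) − ∑_{h=1}^H ∑_{j=1}^d Ent(M^{[h]}_{·,j})`. -/
def Rgpc (d H : ℕ) (z : (Fin d → ℝ) × (ℕ → Matrix (Fin d) (Fin d) ℝ)) : ℝ :=
  -Ent d z.1 - ∑ h ∈ Finset.Icc 1 H, ∑ j, Ent d (fun i => z.2 h i j)

/-- The domain `X_{d,H,a,b} := ∪_{a' ∈ [a,b]} Δ^d_{a'} × (S^d_{a'})^H`. -/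
def Xgpc (d H : ℕ) (a b : ℝ) : Set ((Fin d → ℝ) × (ℕ → Matrix (Fin d) (Fin d) ℝ)) :=
  {z | ∃ a' ∈ Set.Icc a b, z.1 ∈ scaledSimplex d a' ∧
    ∀ h ∈ Finset.Icc 1 H, z.2 h ∈ scaledStochastic d a'}

/-- Euclidean inner product on the parameter space `ℝ^d × (ℝ^{d×d})^H`
(only the blocks `1 ≤ h ≤ H` count). -/
def iprod (d H : ℕ) (z y : (Fin d → ℝ) × (ℕ → Matrix (Fin d) (Fin d) ℝ)) : ℝ :=
  ∑ i, z.1 i * y.1 i + ∑ h ∈ Finset.Icc 1 H, ∑ i, ∑ j, z.2 h i j * y.2 h i j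

/-- The norm `‖(p, M^{[1:H]})‖_{d,H}` with
`‖(p,M)‖² = ‖p‖₁² + ∑_{h=1}^H ∑_{j=1}^d ‖M^{[h]}_{·,j}‖₁²`. -/
def normdH (d H : ℕ) (z : (Fin d → ℝ) × (ℕ → Matrix (Fin d) (Fin d) ℝ)) : ℝ :=
  Real.sqrt ((l1 z.1) ^ 2 + ∑ h ∈ Finset.Icc 1 H, ∑ j, (∑ i, |z.2 h i j|) ^ 2)

/-- The counterfactual loss `ℓ_t(p, M^{[1:H]}) = c_t(x_t(p,M^{[1:H]}), u_t(p,M^{[1:H]}))`. -/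
def lossGPC {d : ℕ} (A B : Matrix (Fin d) (Fin d) ℝ) (γ : ℤ → ℝ) (w : ℤ → Fin d → ℝ)
    (x1 : Fin d → ℝ) (cst : ℕ → (Fin d → ℝ) → (Fin d → ℝ) → ℝ) (H t : ℕ)
    (z : (Fin d → ℝ) × (ℕ → Matrix (Fin d) (Fin d) ℝ)) : ℝ :=
  cst t (traj A B γ w x1 (dacCtrl γ w H z.1 z.2) t) (dacCtrl γ w H z.1 z.2 t)

theorem aux_lamBar_succ (γ : ℤ → ℝ) (t i : ℕ) :
    lamBar γ (t + 1) (i + 1) = (1 - γ (t : ℤ)) * lamBar γ t i := by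
  unfold lamBar
  rw [← Finset.Ico_add_one_right_eq_Icc, ← Finset.Ico_add_one_right_eq_Icc,
    Finset.prod_Ico_eq_prod_range, Finset.prod_Ico_eq_prod_range]
  simp only [Nat.add_sub_cancel]
  rw [Finset.prod_range_succ', mul_comm]
  congr 1
  · push_cast; congr 2; ring
  · apply Finset.prod_congr rfl
    intro j _
    push_cast; congr 2; ring

theorem aux_lam_eq (γ : ℤ → ℝ) (t i : ℕ) :
    lam γ t (i + 1) = γ ((t : ℤ) - (i + 1 : ℕ)) * lamBar γ t i := by
  unfold lam lamBar
  rw [Finset.Ico_add_one_right_eq_Icc]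

theorem aux_lam_succ (γ : ℤ → ℝ) (t i : ℕ) (hi : 1 ≤ i) :
    lam γ (t + 1) (i + 1) = (1 - γ (t : ℤ)) * lam γ t i := by
  obtain ⟨k, rfl⟩ : ∃ k, i = k + 1 := ⟨i - 1, by omega⟩
  rw [aux_lam_eq, aux_lam_eq, aux_lamBar_succ]
  have : ((t + 1 : ℕ) : ℤ) - (k + 1 + 1 : ℕ) = (t : ℤ) - (k + 1 : ℕ) := by push_cast; ring
  rw [this]; ring

theorem aux_lam0 (γ : ℤ → ℝ) (H t : ℕ) : lam0 γ H t = lamBar γ t H := by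
  induction H with
  | zero => simp [lam0, lamBar]
  | succ n ih =>
    have h1 : lam0 γ (n + 1) t = lam0 γ n t - lam γ t (n + 1) := by
      unfold lam0
      rw [Finset.sum_Icc_succ_top (by omega)]; ring
    have h2 : lamBar γ t (n + 1) = lamBar γ t n * (1 - γ ((t : ℤ) - (n + 1 : ℕ))) := by
      unfold lamBar
      rw [Finset.prod_Icc_succ_top (by omega)]
    rw [h1, ih, h2, aux_lam_eq]; ring

theorem aux_lamBar_zero (γ : ℤ → ℝ) (hγ0 : γ 0 = 1) (t i : ℕ) (ht : 1 ≤ t) (h : t ≤ i) :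
    lamBar γ t i = 0 := by
  unfold lamBar
  apply Finset.prod_eq_zero (i := t) (by simp; omega)
  simp [hγ0]

theorem aux_lamBar_nonneg (γ : ℤ → ℝ) (hγ : ∀ t : ℤ, 0 ≤ t → γ t ∈ Set.Icc (0 : ℝ) 1)
    (hγ0 : γ 0 = 1) (t i : ℕ) (ht : 1 ≤ t) : 0 ≤ lamBar γ t i := by
  by_cases h : t ≤ i
  · rw [aux_lamBar_zero γ hγ0 t i ht h]
  · unfold lamBar
    apply Finset.prod_nonneg
    intro j hj
    rw [Finset.mem_Icc] at hj
    have := (hγ ((t : ℤ) - j) (by omega)).2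
    linarith

theorem aux_l1 {d : ℕ} (v : Fin d → ℝ) (h : ∀ i, 0 ≤ v i) : l1 v = ∑ i, v i :=
  Finset.sum_congr rfl fun i _ => abs_of_nonneg (h i)

theorem aux_mulVec {d : ℕ} {a : ℝ} (ha : 0 ≤ a) {M : Matrix (Fin d) (Fin d) ℝ}
    (hM : M ∈ scaledStochastic d a) {v : Fin d → ℝ} (hv : v ∈ simplex d) :
    (∀ i, 0 ≤ M.mulVec v i) ∧ ∑ i, M.mulVec v i = a := by
  obtain ⟨N, hN, rfl⟩ := hM
  constructor
  · intro i
    simp only [Matrix.mulVec, dotProduct]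
    apply Finset.sum_nonneg
    intro j _
    exact mul_nonneg (mul_nonneg ha (hN.1 i j)) (hv.1 j)
  · simp only [Matrix.mulVec, dotProduct, Matrix.smul_apply, smul_eq_mul]
    rw [Finset.sum_comm]
    simp_rw [← Finset.sum_mul, ← Finset.mul_sum, hN.2, mul_one]
    rw [← Finset.mul_sum, hv.2, mul_one]

theorem aux_l1_u {d : ℕ} (H : ℕ) (x1 : Fin d → ℝ) (hx1 : x1 ∈ simplex d)
    (γ : ℤ → ℝ) (w : ℤ → Fin d → ℝ)
    (hγ : ∀ t : ℤ, 0 ≤ t → γ t ∈ Set.Icc (0 : ℝ) 1) (hγ0 : γ 0 = 1)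
    (hw : ∀ t : ℤ, 1 ≤ t → w t ∈ simplex d) (hw0 : w 0 = x1)
    (a : ℝ) (ha : a ∈ Set.Icc (0 : ℝ) 1)
    (p : Fin d → ℝ) (hp : p ∈ scaledSimplex d a)
    (M : ℕ → Matrix (Fin d) (Fin d) ℝ)
    (hM : ∀ j ∈ Finset.Icc 1 H, M j ∈ scaledStochastic d a) (s : ℕ) (hs : 1 ≤ s) :
    l1 (dacCtrl γ w H p M s) = l1 p := by
  obtain ⟨y, hy, rfl⟩ := hp
  have hp0 : ∀ i, 0 ≤ (a • y) i := fun i => mul_nonneg ha.1 (hy.1 i)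
  have hps : ∑ i, (a • y) i = a := by
    simp only [Pi.smul_apply, smul_eq_mul]
    rw [← Finset.mul_sum, hy.2, mul_one]
  have key : ∀ j ∈ Finset.Icc 1 H,
      (∀ i, 0 ≤ lam γ s j * (M j).mulVec (w ((s : ℤ) - j)) i) ∧
      ∑ i, lam γ s j * (M j).mulVec (w ((s : ℤ) - j)) i = lam γ s j * a := by
    intro j hj
    have hj' := Finset.mem_Icc.1 hj
    obtain ⟨k, rfl⟩ : ∃ k, j = k + 1 := ⟨j - 1, by omega⟩
    by_cases h : s ≤ k
    · have h0 : lam γ s (k + 1) = 0 := by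
        rw [aux_lam_eq, aux_lamBar_zero γ hγ0 s k hs h, mul_zero]
      simp [h0]
    · have hws : w ((s : ℤ) - (k + 1 : ℕ)) ∈ simplex d := by
        by_cases h' : s = k + 1
        · subst h'
          rw [sub_self, hw0]; exact hx1
        · exact hw _ (by push_cast; omega)
      have hl : 0 ≤ lam γ s (k + 1) := by
        rw [aux_lam_eq]
        exact mul_nonneg (hγ _ (by push_cast; omega)).1 (aux_lamBar_nonneg γ hγ hγ0 s k hs)
      obtain ⟨h1, h2⟩ := aux_mulVec ha.1 (hM _ hj) hws
      exact ⟨fun i => mul_nonneg hl (h1 i), by rw [← Finset.mul_sum, h2]⟩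
  rw [aux_l1 _ hp0, hps, aux_l1]
  · simp only [dacCtrl, Pi.add_apply, Finset.sum_apply, Finset.sum_add_distrib]
    rw [Finset.sum_comm]
    have e1 : ∑ i, (lam0 γ H s • a • y) i = lam0 γ H s * a := by
      rw [← hps, Finset.mul_sum, hps]; rfl
    have e2 : ∑ j ∈ Finset.Icc 1 H, ∑ i, (lam γ s j • (M j).mulVec (w ((s : ℤ) - j))) i
        = ∑ j ∈ Finset.Icc 1 H, lam γ s j * a :=
      Finset.sum_congr rfl fun j hj => (key j hj).2
    rw [e1, e2, ← Finset.sum_mul]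
    unfold lam0; ring
  · intro i
    simp only [dacCtrl, Pi.add_apply, Finset.sum_apply]
    apply add_nonneg
    · apply mul_nonneg _ (hp0 i)
      rw [aux_lam0]; exact aux_lamBar_nonneg γ hγ hγ0 s H hs
    · exact Finset.sum_nonneg fun j hj => (key j hj).1 i

/-- Closed-form expression for the state of a simplex LDS under a disturbance-action
policy with parameters `p ∈ Δ^d_a`, `M^{[1]}, …, M^{[H]} ∈ S^d_a`: writing `α = ‖p‖₁`,
for every `1 ≤ t ≤ T`,
`x_t = ∑_{i=1}^{t} (1−α)^{i−1} A^{i−1} (λ_{t−i,0} λ̄_{t,i} B p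
      + B ∑_{j=1}^{H} λ_{t,i+j} M^{[j]} w_{t−i−j} + λ_{t,i} w_{t−i})`. -/
theorem simplex_lds_dac_closed_form (d T H : ℕ)
    (A B : Matrix (Fin d) (Fin d) ℝ) (hA : IsStochastic A) (hB : IsStochastic B)
    (x1 : Fin d → ℝ) (hx1 : x1 ∈ simplex d)
    (γ : ℤ → ℝ) (w : ℤ → Fin d → ℝ)
    (hγ : ∀ t : ℤ, 0 ≤ t → γ t ∈ Set.Icc (0 : ℝ) 1) (hγ0 : γ 0 = 1)
    (hw : ∀ t : ℤ, 1 ≤ t → w t ∈ simplex d) (hw0 : w 0 = x1)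
    (hwneg : ∀ t : ℤ, t < 0 → w t = 0)
    (a : ℝ) (ha : a ∈ Set.Icc (0 : ℝ) 1)
    (p : Fin d → ℝ) (hp : p ∈ scaledSimplex d a)
    (M : ℕ → Matrix (Fin d) (Fin d) ℝ)
    (hM : ∀ j ∈ Finset.Icc 1 H, M j ∈ scaledStochastic d a)
    (u : ℕ → Fin d → ℝ)
    (hu : ∀ s : ℕ, 1 ≤ s → u s = dacCtrl γ w H p M s)
    (x : ℕ → Fin d → ℝ) (hxinit : x 1 = x1)
    (hdyn : ∀ t : ℕ, 1 ≤ t →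
      x (t + 1) =
        (1 - γ (t : ℤ)) • ((1 - l1 (u t)) • A.mulVec (x t) + B.mulVec (u t)) +
          γ (t : ℤ) • w (t : ℤ)) :
    ∀ t : ℕ, 1 ≤ t → t ≤ T →
      x t = ∑ i ∈ Finset.Icc 1 t,
        (1 - l1 p) ^ (i - 1) •
          (A ^ (i - 1)).mulVec
            ((lam0 γ H (t - i) * lamBar γ t i) • B.mulVec p +
              B.mulVec (∑ j ∈ Finset.Icc 1 H,
                lam γ t (i + j) • (M j).mulVec (w ((t : ℤ) - i - j))) +
              lam γ t i • w ((t : ℤ) - i)) := by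
  intro t ht _
  induction t, ht using Nat.le_induction with
  | base =>
    have h1 : lamBar γ 1 1 = 0 := aux_lamBar_zero γ hγ0 1 1 le_rfl le_rfl
    have h2 : lam γ 1 1 = 1 := by simp [lam, hγ0]
    have h3 : ∑ j ∈ Finset.Icc 1 H,
        lam γ 1 (1 + j) • (M j).mulVec (w (((1 : ℕ) : ℤ) - (1 : ℕ) - j)) = 0 := by
      apply Finset.sum_eq_zero
      intro j hj
      rw [Finset.mem_Icc] at hj
      rw [add_comm 1 j, aux_lam_eq, aux_lamBar_zero γ hγ0 1 j le_rfl hj.1, mul_zero, zero_smul]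
    rw [Finset.Icc_self, Finset.sum_singleton, h1, h2, h3, hxinit, ← hw0]
    simp
  | succ t ht ih =>
    have hl : l1 (u t) = l1 p := by
      rw [hu t ht]
      exact aux_l1_u H x1 hx1 γ w hγ hγ0 hw hw0 a ha p hp M hM t ht
    rw [hdyn t ht, hl, hu t ht, ih (by omega)]
    rw [← Finset.add_sum_Ioc_eq_sum_Icc (a := 1) (b := t + 1) (by omega)]
    have hshift : Finset.Ioc 1 (t + 1) = (Finset.Icc 1 t).map (addRightEmbedding 1) := by
      ext k; simp only [Finset.mem_Ioc, Finset.mem_map, Finset.mem_Icc, addRightEmbedding_apply]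
      constructor
      · intro h; exact ⟨k - 1, by omega, by omega⟩
      · rintro ⟨j, h, rfl⟩; omega
    rw [hshift, Finset.sum_map]
    have hterm : ∀ i ∈ Finset.Icc 1 t,
        (1 - l1 p) ^ (addRightEmbedding 1 i - 1) •
          (A ^ (addRightEmbedding 1 i - 1)).mulVec
            ((lam0 γ H (t + 1 - addRightEmbedding 1 i) *
                lamBar γ (t + 1) (addRightEmbedding 1 i)) • B.mulVec p +
              B.mulVec (∑ j ∈ Finset.Icc 1 H,
                lam γ (t + 1) (addRightEmbedding 1 i + j) •
                  (M j).mulVec (w (((t + 1 : ℕ) : ℤ) - (addRightEmbedding 1 i : ℕ) - j))) +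
              lam γ (t + 1) (addRightEmbedding 1 i) •
                w (((t + 1 : ℕ) : ℤ) - (addRightEmbedding 1 i : ℕ))) =
        (1 - γ (t : ℤ)) • (1 - l1 p) • A.mulVec ((1 - l1 p) ^ (i - 1) •
          (A ^ (i - 1)).mulVec
            ((lam0 γ H (t - i) * lamBar γ t i) • B.mulVec p +
              B.mulVec (∑ j ∈ Finset.Icc 1 H,
                lam γ t (i + j) • (M j).mulVec (w ((t : ℤ) - i - j))) +
              lam γ t i • w ((t : ℤ) - i))) := by
      intro i hi
      rw [Finset.mem_Icc] at hi
      obtain ⟨k, rfl⟩ : ∃ k, i = k + 1 := ⟨i - 1, by omega⟩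
      simp only [addRightEmbedding_apply, Nat.add_sub_cancel]
      have e1 : ((t + 1 : ℕ) : ℤ) - (k + 1 + 1 : ℕ) = (t : ℤ) - (k + 1 : ℕ) := by
        push_cast; ring
      have e2 : t + 1 - (k + 1 + 1) = t - (k + 1) := by omega
      have e3 : ∀ j, lam γ (t + 1) (k + 1 + 1 + j) = (1 - γ (t : ℤ)) * lam γ t (k + 1 + j) := by
        intro j
        rw [← aux_lam_succ γ t (k + 1 + j) (by omega)]
        congr 1; omega
      rw [e1, e2, aux_lamBar_succ, aux_lam_succ γ t (k + 1) (by omega)]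
      simp_rw [e3, mul_smul]
      rw [← Finset.smul_sum, Matrix.mulVec_smul, Matrix.mulVec_smul, Matrix.mulVec_mulVec,
        ← pow_succ', smul_comm (lam0 γ H (t - (k + 1))) (1 - γ (t : ℤ)), ← smul_add, ← smul_add,
        Matrix.mulVec_smul, pow_succ' (1 - l1 p), mul_smul,
        smul_comm _ (1 - γ (t : ℤ)), smul_comm _ (1 - γ (t : ℤ))]
    rw [Finset.sum_congr rfl hterm, ← Finset.smul_sum, ← Finset.smul_sum, ← Matrix.mulVec_sum]
    have hb : lamBar γ (t + 1) 1 = 1 - γ (t : ℤ) := by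
      rw [aux_lamBar_succ γ t 0]; simp [lamBar]
    have hl1 : lam γ (t + 1) 1 = γ (t : ℤ) := by simp [lam]
    have e1 : ((t + 1 : ℕ) : ℤ) - (1 : ℕ) = (t : ℤ) := by push_cast; ring
    have hs : ∑ j ∈ Finset.Icc 1 H, lam γ (t + 1) (1 + j) • (M j).mulVec (w ((t : ℤ) - j)) =
        (1 - γ (t : ℤ)) • ∑ j ∈ Finset.Icc 1 H, lam γ t j • (M j).mulVec (w ((t : ℤ) - j)) := by
      rw [Finset.smul_sum]
      apply Finset.sum_congr rfl
      intro j hj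
      rw [add_comm 1 j, aux_lam_succ γ t j (Finset.mem_Icc.1 hj).1, mul_smul]
    rw [e1, hb, hl1, hs]
    simp only [Nat.sub_self, pow_zero, one_smul, Matrix.one_mulVec, Nat.add_sub_cancel]
    simp only [dacCtrl, Matrix.mulVec_add, Matrix.mulVec_smul, smul_add, mul_smul]
    rw [smul_comm (lam0 γ H t) (1 - γ (t : ℤ))]
    abel

end
end

section
/- (Approximation of mixing linear policies by disturbance-action policies.) Consider a simplex LDS on Δ^d with transition matrices A, B ∈ S^d, initial state x₁ ∈ Δ^d, noise strengths γ_t ∈ [0,1], noise values w_t ∈ Δ^d, and cost functions c_1,…,c_T that are convex and L-Lipschitz in the sense |c_t(x,u)−c_t(x',u')| ≤ L(‖x−x'‖₁+‖u−u'‖₁). Fix τ > 0, ε ∈ (0,1), and K* ∈ S^d_{≤1} with t_mix(C(K*)) ≤ τ; write α* := ‖K*‖_{1→1}. If H ≥ τ·⌈log₂(2LT²/ε)⌉, then there exist p ∈ Δ^d_{α*} and M^{[1]},…,M^{[H]} ∈ S^d_{α*} such that ∑_{t=1}^T c_t(x_t(p, M^{[1:H]}), u_t(p, M^{[1:H]}))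 − ∑_{t=1}^T c_t(x_t(K*), u_t(K*)) ≤ ε. -/
open Finset

noncomputable section

theorem l1_add_le {d : ℕ} (x y : Fin d → ℝ) : l1 (x + y) ≤ l1 x + l1 y := by
  unfold l1
  rw [← Finset.sum_add_distrib]
  exact Finset.sum_le_sum fun i _ => abs_add_le _ _

theorem l1_sub_le {d : ℕ} (x y : Fin d → ℝ) : l1 (x - y) ≤ l1 x + l1 y := by
  unfold l1
  rw [← Finset.sum_add_distrib]
  exact Finset.sum_le_sum fun i _ => abs_sub _ _

theorem l1_smul {d : ℕ} (a : ℝ) (x : Fin d → ℝ) : l1 (a • x) = |a| * l1 x := by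
  simp [l1, abs_mul, Finset.mul_sum]

theorem l1_nonneg {d : ℕ} (x : Fin d → ℝ) : 0 ≤ l1 x :=
  Finset.sum_nonneg fun _ _ => abs_nonneg _

theorem l1_zero {d : ℕ} : l1 (0 : Fin d → ℝ) = 0 := by simp [l1]

theorem l1_sum_le {d : ℕ} {ι : Type*} (s : Finset ι) (f : ι → Fin d → ℝ) :
    l1 (∑ i ∈ s, f i) ≤ ∑ i ∈ s, l1 (f i) := by
  classical
  induction s using Finset.induction_on with
  | empty => simp [l1]
  | insert a s ha ih =>
    rw [Finset.sum_insert ha, Finset.sum_insert ha]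
    exact (l1_add_le _ _).trans (by linarith)

theorem l1_simplex {d : ℕ} {x : Fin d → ℝ} (hx : x ∈ simplex d) : l1 x = 1 := by
  rw [← hx.2]
  exact Finset.sum_congr rfl fun i _ => abs_of_nonneg (hx.1 i)

theorem mulVec_eq_sum_cols {d : ℕ} (M : Matrix (Fin d) (Fin d) ℝ) (v : Fin d → ℝ) :
    M.mulVec v = ∑ j, v j • M.col j := by
  ext i
  simp [Matrix.mulVec, dotProduct, Finset.sum_apply, mul_comm]

theorem stoch_sum {d : ℕ} {M : Matrix (Fin d) (Fin d) ℝ} (hM : IsStochastic M)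
    (v : Fin d → ℝ) : ∑ i, M.mulVec v i = ∑ i, v i := by
  simp only [Matrix.mulVec, dotProduct]
  rw [Finset.sum_comm]
  refine Finset.sum_congr rfl fun j _ => ?_
  rw [← Finset.sum_mul, hM.2 j, one_mul]

theorem stoch_nonneg {d : ℕ} {M : Matrix (Fin d) (Fin d) ℝ} (hM : IsStochastic M)
    {v : Fin d → ℝ} (hv : ∀ i, 0 ≤ v i) (i : Fin d) : 0 ≤ M.mulVec v i := by
  simp only [Matrix.mulVec, dotProduct]
  exact Finset.sum_nonneg fun j _ => mul_nonneg (hM.1 i j) (hv j)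

theorem stoch_simplex {d : ℕ} {M : Matrix (Fin d) (Fin d) ℝ} (hM : IsStochastic M)
    {v : Fin d → ℝ} (hv : v ∈ simplex d) : M.mulVec v ∈ simplex d :=
  ⟨stoch_nonneg hM hv.1, by rw [stoch_sum hM, hv.2]⟩

theorem stoch_l1_le {d : ℕ} {M : Matrix (Fin d) (Fin d) ℝ} (hM : IsStochastic M)
    (v : Fin d → ℝ) : l1 (M.mulVec v) ≤ l1 v := by
  rw [mulVec_eq_sum_cols]
  refine (l1_sum_le _ _).trans (Finset.sum_le_sum fun j _ => ?_)
  rw [l1_smul, l1_simplex (x := M.col j) ⟨fun i => hM.1 i j, hM.2 j⟩, mul_one]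

theorem simplex_comb {d : ℕ} {x y : Fin d → ℝ} (hx : x ∈ simplex d) (hy : y ∈ simplex d)
    {a b : ℝ} (ha : 0 ≤ a) (hb : 0 ≤ b) (hab : a + b = 1) : a • x + b • y ∈ simplex d := by
  refine ⟨fun i => ?_, ?_⟩
  · have := hx.1 i
    have := hy.1 i
    simp only [Pi.add_apply, Pi.smul_apply, smul_eq_mul]
    positivity
  · simp only [Pi.add_apply, Pi.smul_apply, smul_eq_mul]
    rw [Finset.sum_add_distrib, ← Finset.mul_sum, ← Finset.mul_sum, hx.2, hy.2]
    linarith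

theorem stoch_comb {d : ℕ} {M N : Matrix (Fin d) (Fin d) ℝ} (hM : IsStochastic M)
    (hN : IsStochastic N) {a b : ℝ} (ha : 0 ≤ a) (hb : 0 ≤ b) (hab : a + b = 1) :
    IsStochastic (a • M + b • N) := by
  have h : ∀ j, (a • M.col j + b • N.col j) ∈ simplex d := fun j =>
    simplex_comb ⟨fun i => hM.1 i j, hM.2 j⟩ ⟨fun i => hN.1 i j, hN.2 j⟩ ha hb hab
  exact ⟨fun i j => (h j).1 i, fun j => (h j).2⟩

theorem stoch_mul {d : ℕ} {M N : Matrix (Fin d) (Fin d) ℝ} (hM : IsStochastic M)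
    (hN : IsStochastic N) : IsStochastic (M * N) := by
  have h : ∀ j, M.mulVec (N.col j) ∈ simplex d := fun j =>
    stoch_simplex hM ⟨fun i => hN.1 i j, hN.2 j⟩
  exact ⟨fun i j => (h j).1 i, fun j => (h j).2⟩

theorem stoch_one {d : ℕ} : IsStochastic (1 : Matrix (Fin d) (Fin d) ℝ) := by
  refine ⟨fun i j => ?_, fun j => ?_⟩
  · rw [Matrix.one_apply]; split_ifs <;> norm_num
  · simp [Matrix.one_apply]

theorem stoch_pow {d : ℕ} {M : Matrix (Fin d) (Fin d) ℝ} (hM : IsStochastic M) (n : ℕ) :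
    IsStochastic (M ^ n) := by
  induction n with
  | zero => simpa using stoch_one
  | succ n ih => rw [pow_succ]; exact stoch_mul ih hM

theorem norm11_smul_stoch {d : ℕ} {N : Matrix (Fin d) (Fin d) ℝ} (hN : IsStochastic N)
    {a : ℝ} (ha : 0 ≤ a) {x : Fin d → ℝ} (hx : x ∈ simplex d) : norm11 (a • N) = a := by
  apply IsGreatest.csSup_eq
  constructor
  · refine ⟨x, l1_simplex hx, ?_⟩
    simp only [Matrix.smul_mulVec]
    rw [l1_smul, l1_simplex (stoch_simplex hN hx), abs_of_nonneg ha, mul_one]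
  · rintro _ ⟨y, hy, rfl⟩
    simp only [Matrix.smul_mulVec]
    rw [l1_smul, abs_of_nonneg ha]
    have h1 := stoch_l1_le hN y
    have h2 : l1 y = 1 := hy
    rw [h2] at h1
    nlinarith

theorem contraction {d : ℕ} {X : Matrix (Fin d) (Fin d) ℝ} {π : Fin d → ℝ} {r : ℝ}
    (hX : ∀ p ∈ simplex d, l1 (X.mulVec p - π) ≤ r) {v : Fin d → ℝ} (hv : ∑ i, v i = 0) :
    l1 (X.mulVec v) ≤ r * l1 v := by
  have h : X.mulVec v = ∑ j, v j • (X.col j - π) := by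
    rw [mulVec_eq_sum_cols]
    simp only [smul_sub, Finset.sum_sub_distrib]
    rw [← Finset.sum_smul, hv]
    simp
  rw [h]
  refine (l1_sum_le _ _).trans ?_
  unfold l1
  rw [Finset.mul_sum]
  refine Finset.sum_le_sum fun j _ => ?_
  change l1 _ ≤ _
  rw [l1_smul, mul_comm]
  refine mul_le_mul_of_nonneg_right ?_ (abs_nonneg _)
  have hs : (Pi.single j 1 : Fin d → ℝ) ∈ simplex d := by
    refine ⟨fun i => ?_, by simp⟩
    by_cases hij : i = j
    · subst hij; simp
    · simp [hij]
  have := hX _ hs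
  rwa [Matrix.mulVec_single_one] at this

theorem contraction_pow {d : ℕ} {X : Matrix (Fin d) (Fin d) ℝ} (hXs : IsStochastic X)
    {π : Fin d → ℝ} {r : ℝ} (hr : 0 ≤ r)
    (hX : ∀ p ∈ simplex d, l1 (X.mulVec p - π) ≤ r) (k : ℕ) {v : Fin d → ℝ}
    (hv : ∑ i, v i = 0) :
    l1 ((X ^ k).mulVec v) ≤ r ^ k * l1 v := by
  induction k with
  | zero => simp
  | succ k ih =>
    rw [pow_succ' X, ← Matrix.mulVec_mulVec]
    have h0 : ∑ i, (X ^ k).mulVec v i = 0 := by rw [stoch_sum (stoch_pow hXs k), hv]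
    refine (contraction hX h0).trans ?_
    rw [pow_succ', mul_assoc]
    exact mul_le_mul_of_nonneg_left ih hr

/-- The mixing estimate used in the main proof. -/
theorem mixing_bound {d : ℕ} {C : Matrix (Fin d) (Fin d) ℝ} (hC : IsStochastic C) {t : ℕ}
    (hu : hasUniqueStationary C) (hD : Dmix C t ≤ 1 / 4) :
    ∃ π ∈ simplex d, ∀ k n : ℕ, t * k ≤ n → ∀ q ∈ simplex d,
      l1 (π - (C ^ n).mulVec q) ≤ 2 * (1 / 4) ^ k := by
  have hs : statDist C ∈ simplex d ∧ C.mulVec (statDist C) = statDist C := by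
    unfold statDist
    rw [dif_pos hu]
    exact hu.exists.choose_spec
  obtain ⟨hπ, hfix⟩ := hs
  refine ⟨statDist C, hπ, fun k n hn q hq => ?_⟩
  have hX : ∀ p ∈ simplex d, l1 ((C ^ t).mulVec p - statDist C) ≤ 1 / 4 := by
    intro p hp
    refine le_trans (le_csSup ?_ (Set.mem_image_of_mem
      (fun p => l1 ((C ^ t).mulVec p - statDist C)) hp)) hD
    refine ⟨2, ?_⟩
    rintro _ ⟨y, hy, rfl⟩
    refine (l1_sub_le _ _).trans ?_
    rw [l1_simplex (stoch_simplex (stoch_pow hC t) hy), l1_simplex hπ]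
    norm_num
  have hpow : ∀ m : ℕ, (C ^ m).mulVec (statDist C) = statDist C := by
    intro m
    induction m with
    | zero => simp
    | succ m ih => rw [pow_succ, ← Matrix.mulVec_mulVec, hfix, ih]
  have h1 : statDist C - (C ^ n).mulVec q
      = (C ^ (n - t * k)).mulVec (((C ^ t) ^ k).mulVec (statDist C - q)) := by
    rw [Matrix.mulVec_mulVec, ← pow_mul, ← pow_add, Nat.sub_add_cancel hn, Matrix.mulVec_sub,
      hpow]
  rw [h1]
  refine (stoch_l1_le (stoch_pow hC _) _).trans ?_
  have h0 : ∑ i, (statDist C - q) i = 0 := by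
    simp only [Pi.sub_apply, Finset.sum_sub_distrib]
    rw [hπ.2, hq.2, sub_self]
  refine (contraction_pow (stoch_pow hC t) (by norm_num) hX k h0).trans ?_
  have h2 := l1_sub_le (statDist C) q
  rw [l1_simplex hπ, l1_simplex hq] at h2
  have h3 : (0 : ℝ) ≤ (1 / 4) ^ k := by positivity
  nlinarith

theorem lam_zero_of_lt {γ : ℤ → ℝ} (hγ0 : γ 0 = 1) {t i : ℕ} (ht : 1 ≤ t) (hi : t < i) :
    lam γ t i = 0 := by
  unfold lam
  rw [Finset.prod_eq_zero (i := t) (by simp; omega) (by simp [hγ0]), mul_zero]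

theorem lam_nonneg {γ : ℤ → ℝ} (hγ : ∀ t : ℤ, 0 ≤ t → γ t ∈ Set.Icc (0 : ℝ) 1)
    (hγ0 : γ 0 = 1) {t : ℕ} (ht : 1 ≤ t) (i : ℕ) : 0 ≤ lam γ t i := by
  by_cases hi : t < i
  · rw [lam_zero_of_lt hγ0 ht hi]
  · refine mul_nonneg (hγ _ (by omega)).1 (Finset.prod_nonneg fun j hj => ?_)
    rw [Finset.mem_Ico] at hj
    have := (hγ ((t : ℤ) - j) (by omega)).2
    linarith

theorem lam_one (γ : ℤ → ℝ) (t : ℕ) : lam γ (t + 1) 1 = γ t := by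
  simp [lam]

theorem lam_succ (γ : ℤ → ℝ) (t i : ℕ) :
    lam γ (t + 1) (i + 1 + 1) = (1 - γ t) * lam γ t (i + 1) := by
  unfold lam
  rw [Finset.prod_eq_prod_Ico_succ_bot (by omega : 1 < i + 1 + 1),
    ← Finset.prod_Ico_add' _ 1 (i + 1) 1]
  have h1 : ((t + 1 : ℕ) : ℤ) - ((i + 1 + 1 : ℕ) : ℤ) = (t : ℤ) - ((i + 1 : ℕ) : ℤ) := by
    push_cast; ring
  have h2 : ((t + 1 : ℕ) : ℤ) - ((1 : ℕ) : ℤ) = (t : ℤ) := by push_cast; ring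
  have h3 : ∀ j : ℕ, ((t + 1 : ℕ) : ℤ) - ((j + 1 : ℕ) : ℤ) = (t : ℤ) - (j : ℤ) := by
    intro j; push_cast; ring
  simp only [h1, h2, h3]
  ring

theorem lam_sum {γ : ℤ → ℝ} (hγ0 : γ 0 = 1) (t : ℕ) :
    ∑ i ∈ Finset.range (t + 1), lam γ (t + 1) (i + 1) = 1 := by
  induction t with
  | zero => simp [lam, hγ0]
  | succ t ih =>
    rw [Finset.sum_range_succ']
    simp only [lam_succ γ (t + 1)]
    rw [← Finset.mul_sum, ih, lam_one]
    ring

theorem lam_sum_ge {γ : ℤ → ℝ} (hγ0 : γ 0 = 1) {t : ℕ} (ht : 1 ≤ t) {n : ℕ} (hn : t ≤ n) :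
    ∑ i ∈ Finset.range n, lam γ t (i + 1) = 1 := by
  obtain ⟨s, rfl⟩ : ∃ s, t = s + 1 := ⟨t - 1, by omega⟩
  rw [← lam_sum hγ0 s]
  symm
  refine Finset.sum_subset (by intro a; simp; omega) fun i _ hi => ?_
  refine lam_zero_of_lt hγ0 (by omega) ?_
  simp at hi
  omega

theorem Icc_sum_range {E : Type*} [AddCommMonoid E] (f : ℕ → E) (H : ℕ) :
    ∑ i ∈ Finset.Icc 1 H, f i = ∑ i ∈ Finset.range H, f (i + 1) := by
  rw [Finset.range_eq_Ico, Finset.sum_Ico_add' f 0 H 1]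
  rfl

theorem unroll {d : ℕ} {C : Matrix (Fin d) (Fin d) ℝ} {γ : ℤ → ℝ} {w : ℤ → Fin d → ℝ}
    (hγ0 : γ 0 = 1) (x : ℕ → Fin d → ℝ) (hx1 : x 1 = w 0)
    (hx : ∀ t : ℕ, x (t + 2) = (1 - γ ((t : ℤ) + 1)) • C.mulVec (x (t + 1))
      + γ ((t : ℤ) + 1) • w ((t : ℤ) + 1)) (t : ℕ) :
    x (t + 1) = ∑ i ∈ Finset.range (t + 1),
      lam γ (t + 1) (i + 1) • (C ^ i).mulVec (w (((t + 1 : ℕ) : ℤ) - ((i + 1 : ℕ) : ℤ))) := by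
  induction t with
  | zero => simp [lam, hγ0, hx1]
  | succ t ih =>
    rw [Finset.sum_range_succ', hx t, ih]
    simp only [lam_succ γ (t + 1)]
    rw [zero_add, lam_one, Matrix.mulVec_sum, Finset.smul_sum]
    congr 1
    · refine Finset.sum_congr rfl fun i _ => ?_
      rw [Matrix.mulVec_smul, smul_smul, Matrix.mulVec_mulVec, ← pow_succ']
      push_cast
      congr 3
      ring
    · simp

theorem unroll_ge {d : ℕ} {C : Matrix (Fin d) (Fin d) ℝ} {γ : ℤ → ℝ} {w : ℤ → Fin d → ℝ}
    (hγ0 : γ 0 = 1) (x : ℕ → Fin d → ℝ) (hx1 : x 1 = w 0)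
    (hx : ∀ t : ℕ, x (t + 2) = (1 - γ ((t : ℤ) + 1)) • C.mulVec (x (t + 1))
      + γ ((t : ℤ) + 1) • w ((t : ℤ) + 1)) {t : ℕ} (ht : 1 ≤ t) {n : ℕ} (hn : t ≤ n) :
    x t = ∑ i ∈ Finset.range n,
      lam γ t (i + 1) • (C ^ i).mulVec (w ((t : ℤ) - ((i + 1 : ℕ) : ℤ))) := by
  obtain ⟨s, rfl⟩ : ∃ s, t = s + 1 := ⟨t - 1, by omega⟩
  rw [unroll hγ0 x hx1 hx s]
  refine Finset.sum_subset (by intro a; simp; omega) fun i _ hi => ?_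
  rw [lam_zero_of_lt hγ0 (by omega), zero_smul]
  simp at hi
  omega

/-- Approximation of mixing linear policies by disturbance-action policies
(Lemma "Approximation").  For a simplex LDS with convex `L`-Lipschitz costs, any
linear policy `K* ∈ S^d_{≤1}` with `t_mix(C(K*)) ≤ τ`, any `ε ∈ (0,1)`, and any
`H ≥ τ·⌈log₂(2LT²/ε)⌉`, there is a disturbance-action policy with parameters
`p ∈ Δ^d_{α*}`, `M^{[1]}, …, M^{[H]} ∈ S^d_{α*}` (where `α* = ‖K*‖_{1→1}`) whose total
cost exceeds that of the policy `u_t = K* x_t` by at most `ε`. -/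
theorem dac_approximates_mixing_linear_policy (d T H : ℕ)
    (A B : Matrix (Fin d) (Fin d) ℝ) (hA : IsStochastic A) (hB : IsStochastic B)
    (x1 : Fin d → ℝ) (hx1 : x1 ∈ simplex d)
    (γ : ℤ → ℝ) (w : ℤ → Fin d → ℝ)
    (hγ : ∀ t : ℤ, 0 ≤ t → γ t ∈ Set.Icc (0 : ℝ) 1) (hγ0 : γ 0 = 1)
    (hw : ∀ t : ℤ, 1 ≤ t → w t ∈ simplex d) (hw0 : w 0 = x1)
    (hwneg : ∀ t : ℤ, t < 0 → w t = 0)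
    (L : ℝ) (hL : 0 < L)
    (c : ℕ → (Fin d → ℝ) → (Fin d → ℝ) → ℝ)
    (hconv : ∀ t ∈ Finset.Icc 1 T,
      ConvexOn ℝ ((simplex d) ×ˢ (ISet d 0 1))
        (fun q : (Fin d → ℝ) × (Fin d → ℝ) => c t q.1 q.2))
    (hlip : ∀ t ∈ Finset.Icc 1 T, ∀ x ∈ simplex d, ∀ x' ∈ simplex d,
      ∀ u ∈ ISet d 0 1, ∀ u' ∈ ISet d 0 1,
        |c t x u - c t x' u'| ≤ L * (l1 (x - x') + l1 (u - u')))
    (τ : ℝ) (hτ : 0 < τ) (ε : ℝ) (hε : ε ∈ Set.Ioo (0 : ℝ) 1)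
    (K : Matrix (Fin d) (Fin d) ℝ) (hK : K ∈ stochasticLeOne d)
    (hKmix : tmixLE (CK A B K) τ)
    (hH : τ * (⌈Real.logb 2 (2 * L * (T : ℝ) ^ 2 / ε)⌉ : ℝ) ≤ (H : ℝ)) :
    ∃ p ∈ scaledSimplex d (norm11 K),
      ∃ M : ℕ → Matrix (Fin d) (Fin d) ℝ,
        (∀ j ∈ Finset.Icc 1 H, M j ∈ scaledStochastic d (norm11 K)) ∧
        (∑ t ∈ Finset.Icc 1 T,
            c t (traj A B γ w x1 (dacCtrl γ w H p M) t) (dacCtrl γ w H p M t)) -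
          (∑ t ∈ Finset.Icc 1 T,
            c t (trajK A B γ w x1 K t) (K.mulVec (trajK A B γ w x1 K t))) ≤ ε := by
  obtain ⟨a, ⟨ha0, ha1⟩, N, hN, rfl⟩ := hK
  have hnorm : norm11 (a • N) = a := norm11_smul_stoch hN ha0 hx1
  have hCeq : CK A B (a • N) = (1 - a) • A + a • (B * N) := by
    unfold CK
    rw [hnorm, Matrix.mul_smul]
  have hC : IsStochastic (CK A B (a • N)) := by
    rw [hCeq]
    exact stoch_comb hA (stoch_mul hB hN) (by linarith) ha0 (by ring)
  obtain ⟨t0, ht0, hu, hD⟩ := hKmix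
  obtain ⟨π, hπ, hmix⟩ := mixing_bound hC hu hD
  have hCv : ∀ v, (1 - a) • A.mulVec v + B.mulVec ((a • N).mulVec v)
      = (CK A B (a • N)).mulVec v := by
    intro v
    rw [hCeq, Matrix.add_mulVec, Matrix.smul_mulVec, Matrix.smul_mulVec, Matrix.smul_mulVec,
      Matrix.mulVec_smul, Matrix.mulVec_mulVec]
  generalize CK A B (a • N) = C at hCeq hC hmix hCv
  rw [hnorm]
  -- basic facts about K
  have hKl1 : ∀ v ∈ simplex d, l1 ((a • N).mulVec v) = a := by
    intro v hv
    rw [Matrix.smul_mulVec, l1_smul, l1_simplex (stoch_simplex hN hv), abs_of_nonneg ha0,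
      mul_one]
  have hKI : ∀ v ∈ simplex d, (a • N).mulVec v ∈ ISet d 0 1 := by
    intro v hv
    exact ⟨a, ⟨ha0, ha1⟩, N.mulVec v, stoch_simplex hN hv, Matrix.smul_mulVec _ _ _⟩
  have hKle : ∀ v, l1 ((a • N).mulVec v) ≤ l1 v := by
    intro v
    rw [Matrix.smul_mulVec, l1_smul, abs_of_nonneg ha0]
    have h1 := stoch_l1_le hN v
    have h2 := l1_nonneg (N.mulVec v)
    nlinarith
  have hw' : ∀ t : ℤ, 0 ≤ t → w t ∈ simplex d := by
    intro t ht
    rcases eq_or_lt_of_le ht with h | h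
    · rw [← h, hw0]; exact hx1
    · exact hw t (by omega)
  -- the linear trajectory
  have hxKs : ∀ t : ℕ, trajK A B γ w x1 (a • N) (t + 1) ∈ simplex d := by
    intro t
    induction t with
    | zero => simpa [trajK] using hx1
    | succ t ih =>
      have hg := hγ ((t : ℤ) + 1) (by omega)
      rw [trajK, hKl1 _ ih, hCv]
      exact simplex_comb (stoch_simplex hC ih) (hw' _ (by omega)) (by linarith [hg.2]) hg.1
        (by ring)
  have hxKrec : ∀ t : ℕ, trajK A B γ w x1 (a • N) (t + 2)
      = (1 - γ ((t : ℤ) + 1)) • C.mulVec (trajK A B γ w x1 (a • N) (t + 1))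
        + γ ((t : ℤ) + 1) • w ((t : ℤ) + 1) := by
    intro t
    rw [trajK, hKl1 _ (hxKs t), hCv]
  have hxK1 : trajK A B γ w x1 (a • N) 1 = w 0 := by rw [hw0, trajK]
  -- the disturbance-action control
  let y : ℕ → Fin d → ℝ := fun t => lam0 γ H t • π + ∑ i ∈ Finset.range H,
    lam γ t (i + 1) • (C ^ i).mulVec (w ((t : ℤ) - ((i + 1 : ℕ) : ℤ)))
  let M : ℕ → Matrix (Fin d) (Fin d) ℝ := fun j => (a • N) * C ^ (j - 1)
  have hu_eq : ∀ t, dacCtrl γ w H ((a • N).mulVec π) M t = (a • N).mulVec (y t) := by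
    intro t
    simp only [dacCtrl, y, M]
    rw [Icc_sum_range, Matrix.mulVec_add, Matrix.mulVec_smul, Matrix.mulVec_sum]
    congr 1
    refine Finset.sum_congr rfl fun i _ => ?_
    rw [Matrix.mulVec_smul, Matrix.mulVec_mulVec, Nat.add_sub_cancel]
  have hlam0 : ∀ t : ℕ, 1 ≤ t → lam0 γ H t = ∑ i ∈ Finset.range t, lam γ t (H + i + 1) := by
    intro t ht
    have h := lam_sum_ge hγ0 ht (Nat.le_add_left t H)
    rw [Finset.sum_range_add] at h
    unfold lam0
    rw [Icc_sum_range]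
    linarith
  have hys : ∀ t : ℕ, 1 ≤ t → y t ∈ simplex d := by
    intro t ht
    have hl0 : 0 ≤ lam0 γ H t := by
      rw [hlam0 t ht]
      exact Finset.sum_nonneg fun i _ => lam_nonneg hγ hγ0 ht _
    have key : ∀ i : ℕ, lam γ t (i + 1) = 0 ∨
        (C ^ i).mulVec (w ((t : ℤ) - ((i + 1 : ℕ) : ℤ))) ∈ simplex d := by
      intro i
      by_cases hi : t < i + 1
      · exact Or.inl (lam_zero_of_lt hγ0 ht hi)
      · exact Or.inr (stoch_simplex (stoch_pow hC i) (hw' _ (by omega)))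
    refine ⟨fun j => ?_, ?_⟩
    · simp only [y, Pi.add_apply, Pi.smul_apply, Finset.sum_apply, smul_eq_mul]
      refine add_nonneg (mul_nonneg hl0 (hπ.1 j)) (Finset.sum_nonneg fun i _ => ?_)
      rcases key i with h | h
      · rw [h, zero_mul]
      · exact mul_nonneg (lam_nonneg hγ hγ0 ht _) (h.1 j)
    · simp only [y, Pi.add_apply, Pi.smul_apply, Finset.sum_apply, smul_eq_mul]
      rw [Finset.sum_add_distrib, ← Finset.mul_sum, hπ.2, Finset.sum_comm]
      have : ∀ i ∈ Finset.range H, ∑ j, lam γ t (i + 1) *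
          (C ^ i).mulVec (w ((t : ℤ) - ((i + 1 : ℕ) : ℤ))) j = lam γ t (i + 1) := by
        intro i _
        rw [← Finset.mul_sum]
        rcases key i with h | h
        · rw [h, zero_mul]
        · rw [h.2, mul_one]
      rw [Finset.sum_congr rfl this]
      unfold lam0
      rw [Icc_sum_range]
      ring
  -- choice of the number of mixing blocks
  obtain ⟨k, hk⟩ : ∃ k : ℕ, k = ⌈Real.logb 2 (2 * L * (T : ℝ) ^ 2 / ε)⌉.toNat := ⟨_, rfl⟩
  have hkH : t0 * k ≤ H := by
    rcases le_total ⌈Real.logb 2 (2 * L * (T : ℝ) ^ 2 / ε)⌉ 0 with h | h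
    · rw [hk, Int.toNat_of_nonpos h]; simp
    · have h1 : ((k : ℕ) : ℝ) = (⌈Real.logb 2 (2 * L * (T : ℝ) ^ 2 / ε)⌉ : ℝ) := by
        have h0 := Int.toNat_of_nonneg h
        rw [← hk] at h0
        rw [← h0, Int.cast_natCast]
      have h2 : (t0 : ℝ) * k ≤ τ * k := mul_le_mul_of_nonneg_right ht0 (Nat.cast_nonneg _)
      rw [← h1] at hH
      exact_mod_cast h2.trans hH
  obtain ⟨δ, hδ⟩ : ∃ δ : ℝ, δ = 2 * (1 / 4) ^ k := ⟨_, rfl⟩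
  have hδ0 : 0 ≤ δ := by rw [hδ]; positivity
  have hfinal : L * (T : ℝ) ^ 2 * δ ≤ ε := by
    rcases Nat.eq_zero_or_pos T with hT | hT
    · subst hT; simpa using hε.1.le
    · have hTr : (0 : ℝ) < T := by exact_mod_cast hT
      have hεp := hε.1
      have hpos : 0 < 2 * L * (T : ℝ) ^ 2 / ε := by positivity
      have h1 : Real.logb 2 (2 * L * (T : ℝ) ^ 2 / ε) ≤ ((k : ℕ) : ℝ) := by
        refine (Int.le_ceil _).trans ?_
        have h0 := Int.self_le_toNat ⌈Real.logb 2 (2 * L * (T : ℝ) ^ 2 / ε)⌉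
        rw [← hk] at h0
        have h0' := Int.cast_le (R := ℝ) |>.2 h0
        rwa [Int.cast_natCast] at h0'
      have h2 : 2 * L * (T : ℝ) ^ 2 / ε ≤ 2 ^ k := by
        have := (Real.logb_le_iff_le_rpow (by norm_num) hpos).1 h1
        rwa [Real.rpow_natCast] at this
      rw [div_le_iff₀ hεp] at h2
      have h3 : (2 : ℝ) ^ k * (1 / 4) ^ k ≤ 1 := by
        rw [← mul_pow]
        exact pow_le_one₀ (by norm_num) (by norm_num)
      have h4 : (0 : ℝ) ≤ (1 / 4) ^ k := by positivity
      calc L * (T : ℝ) ^ 2 * δ = (2 * L * (T : ℝ) ^ 2) * (1 / 4) ^ k := by rw [hδ]; ring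
        _ ≤ (2 ^ k * ε) * (1 / 4) ^ k := mul_le_mul_of_nonneg_right h2 h4
        _ = (2 ^ k * (1 / 4) ^ k) * ε := by ring
        _ ≤ 1 * ε := mul_le_mul_of_nonneg_right h3 hεp.le
        _ = ε := one_mul _
  -- closeness of the surrogate states
  have hyx : ∀ t : ℕ, 1 ≤ t → l1 (y t - trajK A B γ w x1 (a • N) t) ≤ δ := by
    intro t ht
    have h1 : y t - trajK A B γ w x1 (a • N) t = ∑ i ∈ Finset.range t,
        lam γ t (H + i + 1) • (π -
          (C ^ (H + i)).mulVec (w ((t : ℤ) - ((H + i + 1 : ℕ) : ℤ)))) := by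
      rw [unroll_ge hγ0 _ hxK1 hxKrec ht (Nat.le_add_left t H), Finset.sum_range_add]
      simp only [y, smul_sub, Finset.sum_sub_distrib]
      rw [← Finset.sum_smul, ← hlam0 t ht]
      abel
    rw [h1]
    refine (l1_sum_le _ _).trans ?_
    have h2 : ∀ i ∈ Finset.range t, l1 (lam γ t (H + i + 1) • (π -
          (C ^ (H + i)).mulVec (w ((t : ℤ) - ((H + i + 1 : ℕ) : ℤ)))))
        ≤ lam γ t (H + i + 1) * δ := by
      intro i _
      rw [l1_smul, abs_of_nonneg (lam_nonneg hγ hγ0 ht _)]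
      by_cases hi : t < H + i + 1
      · rw [lam_zero_of_lt hγ0 ht hi]; simp
      · refine mul_le_mul_of_nonneg_left ?_ (lam_nonneg hγ hγ0 ht _)
        rw [hδ]
        exact hmix k (H + i) (by omega) _ (hw' _ (by omega))
    refine (Finset.sum_le_sum h2).trans ?_
    rw [← Finset.sum_mul]
    have h3 := lam_sum_ge hγ0 ht (Nat.le_add_left t H)
    rw [Finset.sum_range_add] at h3
    have h4 : 0 ≤ ∑ i ∈ Finset.range H, lam γ t (i + 1) :=
      Finset.sum_nonneg fun i _ => lam_nonneg hγ hγ0 ht _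
    have h5 : ∑ i ∈ Finset.range t, lam γ t (H + i + 1) ≤ 1 := by linarith
    nlinarith
  have huu : ∀ t : ℕ, 1 ≤ t → l1 ((a • N).mulVec (y t)
      - (a • N).mulVec (trajK A B γ w x1 (a • N) t)) ≤ δ := by
    intro t ht
    rw [← Matrix.mulVec_sub]
    exact (hKle _).trans (hyx t ht)
  -- the state trajectory of the disturbance-action policy
  refine ⟨(a • N).mulVec π, ⟨N.mulVec π, stoch_simplex hN hπ, Matrix.smul_mulVec _ _ _⟩, M,
    fun j _ => ⟨N * C ^ (j - 1), stoch_mul hN (stoch_pow hC _), Matrix.smul_mul _ _ _⟩, ?_⟩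
  have hfun : dacCtrl γ w H ((a • N).mulVec π) M = fun t => (a • N).mulVec (y t) :=
    funext hu_eq
  rw [hfun]
  generalize hz : traj A B γ w x1 (fun t => (a • N).mulVec (y t)) = z
  have hz1 : z 1 = x1 := by rw [← hz, traj]
  have hzrec : ∀ t : ℕ, z (t + 2) = (1 - γ ((t : ℤ) + 1)) •
      ((1 - a) • A.mulVec (z (t + 1)) + a • (B * N).mulVec (y (t + 1)))
        + γ ((t : ℤ) + 1) • w ((t : ℤ) + 1) := by
    intro t
    rw [← hz, traj, hKl1 _ (hys (t + 1) (by omega)), Matrix.smul_mulVec, Matrix.mulVec_smul,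
      Matrix.mulVec_mulVec]
  have hzs : ∀ t : ℕ, z (t + 1) ∈ simplex d := by
    intro t
    induction t with
    | zero => rw [zero_add, hz1]; exact hx1
    | succ t ih =>
      have hg := hγ ((t : ℤ) + 1) (by omega)
      rw [hzrec t]
      refine simplex_comb (simplex_comb (stoch_simplex hA ih)
        (stoch_simplex (stoch_mul hB hN) (hys _ (by omega))) (by linarith) ha0 (by ring))
        (hw' _ (by omega)) (by linarith [hg.2]) hg.1 (by ring)
  have hzx : ∀ t : ℕ, l1 (z (t + 1) - trajK A B γ w x1 (a • N) (t + 1)) ≤ t * δ := by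
    intro t
    induction t with
    | zero => rw [zero_add, hz1, hxK1, hw0, sub_self, l1_zero]; simp
    | succ t ih =>
      have hg := hγ ((t : ℤ) + 1) (by omega)
      have h1 : z (t + 2) - trajK A B γ w x1 (a • N) (t + 2) = (1 - γ ((t : ℤ) + 1)) •
          ((1 - a) • A.mulVec (z (t + 1) - trajK A B γ w x1 (a • N) (t + 1)) +
            a • (B * N).mulVec (y (t + 1) - trajK A B γ w x1 (a • N) (t + 1))) := by
        rw [hzrec, hxKrec, hCeq, Matrix.add_mulVec, Matrix.smul_mulVec, Matrix.smul_mulVec,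
          Matrix.mulVec_sub, Matrix.mulVec_sub]
        module
      rw [h1, l1_smul, abs_of_nonneg (by linarith [hg.2])]
      have h2 := stoch_l1_le hA (z (t + 1) - trajK A B γ w x1 (a • N) (t + 1))
      have h3 := stoch_l1_le (stoch_mul hB hN)
        (y (t + 1) - trajK A B γ w x1 (a • N) (t + 1))
      have h4 := hyx (t + 1) (by omega)
      have h5 := l1_add_le ((1 - a) • A.mulVec (z (t + 1) - trajK A B γ w x1 (a • N) (t + 1)))
        (a • (B * N).mulVec (y (t + 1) - trajK A B γ w x1 (a • N) (t + 1)))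
      rw [l1_smul, l1_smul, abs_of_nonneg ha0, abs_of_nonneg (by linarith : 0 ≤ 1 - a)] at h5
      have h6 : (1 - a) * l1 (A.mulVec (z (t + 1) - trajK A B γ w x1 (a • N) (t + 1)))
          ≤ 1 * (t * δ) :=
        mul_le_mul (by linarith) (h2.trans ih) (l1_nonneg _) (by norm_num)
      have h7 : a * l1 ((B * N).mulVec (y (t + 1) - trajK A B γ w x1 (a • N) (t + 1)))
          ≤ 1 * δ :=
        mul_le_mul ha1 (h3.trans h4) (l1_nonneg _) (by norm_num)
      have h8 := h5.trans (add_le_add h6 h7)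
      refine (mul_le_mul (by linarith [hg.1] : 1 - γ ((t : ℤ) + 1) ≤ 1) h8 (l1_nonneg _)
        (by norm_num)).trans (le_of_eq ?_)
      push_cast
      ring
  -- conclusion
  rw [← Finset.sum_sub_distrib]
  have hterm : ∀ t ∈ Finset.Icc 1 T,
      c t (z t) ((a • N).mulVec (y t)) - c t (trajK A B γ w x1 (a • N) t)
        ((a • N).mulVec (trajK A B γ w x1 (a • N) t)) ≤ L * (T * δ) := by
    intro t ht
    obtain ⟨ht1, htT⟩ := Finset.mem_Icc.1 ht
    obtain ⟨s, rfl⟩ : ∃ s, t = s + 1 := ⟨t - 1, by omega⟩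
    refine (le_abs_self _).trans ((hlip _ ht _ (hzs s) _ (hxKs s) _ (hKI _ (hys _ ht1)) _
      (hKI _ (hxKs s))).trans ?_)
    refine mul_le_mul_of_nonneg_left ?_ hL.le
    have h1 := hzx s
    have h2 := huu (s + 1) ht1
    have h3 : ((s : ℝ) + 1) ≤ T := by exact_mod_cast htT
    nlinarith
  refine (Finset.sum_le_sum hterm).trans ?_
  rw [Finset.sum_const, Nat.card_Icc, nsmul_eq_mul, Nat.add_sub_cancel]
  calc (T : ℝ) * (L * (T * δ)) = L * (T : ℝ) ^ 2 * δ := by ring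
    _ ≤ ε := hfinal

end
end
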